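/- Let f : A → B be a morphism of filtered complexes and r ≥ 0. If f has the left lifting property with respect to every morphism g of filtered complexes such that Z_r(g) is bidegree-wise surjective, then f is an E_r-quasi-isomorphism. -/

import Mathlib

open scoped Classical

/-- A filtered (cochain) complex of `R`-modules, with differentials given in
"all indices" form: `d i j` is the differential `X i → X j`, which vanishes
unless `j = i + 1`. The filtration `F n` on `X n` is increasing and preserved
by the differential. -/
structure FilteredComplex (R : Type) [CommRing R] where
  X : ℤ → Type
  [addgrp : ∀ n, AddCommGroup (X n)]
  [mod : ∀ n, Module R (X n)]
  d : ∀ i j : ℤ, X i →ₗ[R] X j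
  d_ne : ∀ i j, j ≠ i + 1 → d i j = 0
  d_sq : ∀ i j k x, d j k (d i j x) = 0
  F : ∀ n, ℤ → Submodule R (X n)
  F_mono : ∀ n, Monotone (F n)
  d_filt : ∀ i j p x, x ∈ F i p → d i j x ∈ F j p

attribute [instance] FilteredComplex.addgrp FilteredComplex.mod

variable {R : Type} [CommRing R]

/-- The `r`-cycles `Z_r^{p,n+p}(A) = F_p A^n ∩ d⁻¹(F_{p-r} A^{n+1})`. -/
def Zc (A : FilteredComplex R) (r : ℕ) (p n : ℤ) : Submodule R (A.X n) :=
  A.F n p ⊓ (A.F (n+1) (p - (r:ℤ))).comap (A.d n (n+1))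

/-- The `r`-boundaries `B_r^{p,n+p}(A) = Z_{r-1}^{p-1,n+p-1}(A) + d Z_{r-1}^{p+r-1,n+p+r-2}(A)`
(for `r ≥ 1`; for `r = 0` this agrees with `B_0 = Z_0^{p-1}`). -/
def Bd (A : FilteredComplex R) (r : ℕ) (p n : ℤ) : Submodule R (A.X n) :=
  Zc A (r-1) (p-1) n ⊔ (Zc A (r-1) (p + (r:ℤ) - 1) (n-1)).map (A.d (n-1) n)

/-- Morphisms of filtered complexes. -/
structure FCHom (A B : FilteredComplex R) where
  f : ∀ n, A.X n →ₗ[R] B.X n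
  comm : ∀ i j x, f j (A.d i j x) = B.d i j (f i x)
  filt : ∀ n p x, x ∈ A.F n p → f n x ∈ B.F n p

def FCHom.comp {A B C : FilteredComplex R} (g : FCHom B C) (φ : FCHom A B) : FCHom A C where
  f := fun n => (g.f n).comp (φ.f n)
  comm := by intro i j x; simp [LinearMap.comp_apply, φ.comm, g.comm]
  filt := fun n p x hx => g.filt n p _ (φ.filt n p x hx)

def FCHom.id' (A : FilteredComplex R) : FCHom A A :=
  ⟨fun _ => LinearMap.id, fun _ _ _ => rfl, fun _ _ _ hx => hx⟩

def FCHom.zero (A B : FilteredComplex R) : FCHom A B :=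
  ⟨fun _ => 0, by intro i j x; simp, by intro n p x _; simp⟩

/-- `Z_r(φ)` is bidegree-wise surjective. -/
def ZSurjF {A B : FilteredComplex R} (φ : FCHom A B) (r : ℕ) : Prop :=
  ∀ p n, ∀ b ∈ Zc B r p n, ∃ a ∈ Zc A r p n, φ.f n a = b

/-- `E_r(φ)` is bidegree-wise surjective (elementwise formulation, `r ≥ 1` pages). -/
def ESurjF {A B : FilteredComplex R} (φ : FCHom A B) (r : ℕ) : Prop :=
  ∀ p n, ∀ b ∈ Zc B r p n, ∃ a ∈ Zc A r p n, φ.f n a - b ∈ Bd B r p n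

/-- `E_r(φ)` is bidegree-wise injective (elementwise formulation). -/
def EInjF {A B : FilteredComplex R} (φ : FCHom A B) (r : ℕ) : Prop :=
  ∀ p n, ∀ a ∈ Zc A r p n, φ.f n a ∈ Bd B r p n → a ∈ Bd A r p n

/-- `φ` is an `E_r`-quasi-isomorphism: `E_{r+1}(φ)` is an isomorphism. -/
def IsErQisF {A B : FilteredComplex R} (φ : FCHom A B) (r : ℕ) : Prop :=
  ESurjF φ (r+1) ∧ EInjF φ (r+1)

/-- The `r`-shift `S^r`: `(S^r F)_p A^n = F_{p + r n} A^n`. -/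
def Shift (r : ℕ) (A : FilteredComplex R) : FilteredComplex R :=
  { A with
    F := fun n p => A.F n (p + (r:ℤ) * n)
    F_mono := fun n _ _ h => A.F_mono n (by omega)
    d_filt := by
      intro i j p x hx
      by_cases h : j = i + 1
      · subst h
        refine A.F_mono (i+1) ?_ (A.d_filt i (i+1) _ x hx)
        have hr : (0:ℤ) ≤ (r:ℤ) := Int.natCast_nonneg r
        nlinarith
      · rw [A.d_ne i j h]; simp }

/-- The `r`-décalage `Dec^r`: `(Dec^r F)_p A^n = F_{p - rn} A^n ∩ d⁻¹(F_{p-r(n+1)} A^{n+1})`. -/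
def Dec (r : ℕ) (A : FilteredComplex R) : FilteredComplex R :=
  { A with
    F := fun n p => A.F n (p - (r:ℤ) * n) ⊓
      (A.F (n+1) (p - (r:ℤ) * (n+1))).comap (A.d n (n+1))
    F_mono := fun n a b h => inf_le_inf (A.F_mono n (by omega))
      (Submodule.comap_mono (A.F_mono (n+1) (by omega)))
    d_filt := by
      intro i j p x hx
      by_cases h : j = i + 1
      · subst h
        rw [Submodule.mem_inf] at hx ⊢
        refine ⟨hx.2, ?_⟩
        rw [Submodule.mem_comap, A.d_sq]
        exact Submodule.zero_mem _
      · rw [A.d_ne i j h]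
        exact Submodule.zero_mem _ }

/-- Shift of a morphism. -/
def ShiftHom (r : ℕ) {A B : FilteredComplex R} (φ : FCHom A B) :
    FCHom (Shift r A) (Shift r B) :=
  ⟨φ.f, φ.comm, fun n p x hx => φ.filt n (p + (r:ℤ) * n) x hx⟩

theorem mem_Zc_iff (A : FilteredComplex R) (r : ℕ) (p : ℤ) {n m : ℤ} (h : m = n + 1)
    (x : A.X n) : x ∈ Zc A r p n ↔ x ∈ A.F n p ∧ A.d n m x ∈ A.F m (p - r) := by
  subst h
  rfl

theorem FCHom.map_mem_Zc {A B : FilteredComplex R} (φ : FCHom A B) {r : ℕ} {p n : ℤ}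
    {x : A.X n} (hx : x ∈ Zc A r p n) : φ.f n x ∈ Zc B r p n := by
  rw [mem_Zc_iff _ _ _ rfl] at hx ⊢
  refine ⟨φ.filt _ _ _ hx.1, ?_⟩
  rw [← φ.comm]
  exact φ.filt _ _ _ hx.2

theorem FCHom.map_mem_Bd {A B : FilteredComplex R} (φ : FCHom A B) {r : ℕ} {p n : ℤ}
    {x : A.X n} (hx : x ∈ Bd A r p n) : φ.f n x ∈ Bd B r p n := by
  obtain ⟨y, hy, _, ⟨w, hw, rfl⟩, rfl⟩ := Submodule.mem_sup.1 hx
  rw [map_add, φ.comm]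
  exact Submodule.add_mem_sup (φ.map_mem_Zc hy) (Submodule.mem_map_of_mem (φ.map_mem_Zc hw))

namespace FilteredComplex

/-- The direct sum of two filtered complexes. -/
def prod (A B : FilteredComplex R) : FilteredComplex R where
  X n := A.X n × B.X n
  d i j := (A.d i j).prodMap (B.d i j)
  d_ne i j h := by rw [A.d_ne i j h, B.d_ne i j h, LinearMap.prodMap_zero]
  d_sq i j k x := Prod.ext (A.d_sq i j k x.1) (B.d_sq i j k x.2)
  F n p := (A.F n p).prod (B.F n p)
  F_mono n _ _ h := Submodule.prod_mono (A.F_mono n h) (B.F_mono n h)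
  d_filt i j p x hx := ⟨A.d_filt i j p _ hx.1, B.d_filt i j p _ hx.2⟩

/-- The identity `X i → X j` if `i = j`, and zero otherwise. -/
def transport (A : FilteredComplex R) (i j : ℤ) : A.X i →ₗ[R] A.X j :=
  if h : i = j then h ▸ LinearMap.id else 0

@[simp]
theorem transport_self (A : FilteredComplex R) (i : ℤ) (x : A.X i) : A.transport i i x = x := by
  simp [transport]

theorem transport_of_ne (A : FilteredComplex R) {i j : ℤ} (h : i ≠ j) : A.transport i j = 0 :=
  dif_neg h

theorem transport_mem (A : FilteredComplex R) (i j p : ℤ) {x : A.X i} (hx : x ∈ A.F i p) :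
    A.transport i j x ∈ A.F j p := by
  by_cases h : i = j
  · subst h
    simpa using hx
  · simp [A.transport_of_ne h]

theorem transport_d (A : FilteredComplex R) (i j k : ℤ) (x : A.X i) :
    A.transport j (k - 1) (A.d i j x) = A.d (j - 1) (k - 1) (A.transport i (j - 1) x) := by
  by_cases h : i = j - 1
  · subst h
    by_cases h' : j = k - 1
    · subst h'
      simp
    · rw [A.transport_of_ne h', A.d_ne (j - 1) (k - 1) (by omega)]
      simp
  · rw [A.transport_of_ne h, A.d_ne i j (by omega)]
    simp

theorem mem_of_transport_sub_mem (A : FilteredComplex R) {n m p : ℤ} (h : n = m)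
    {x : A.X n} {y : A.X (n - 1)}
    (hxy : A.transport n m x - A.d (n - 1) m y ∈ A.F m p) :
    x - A.d (n - 1) n y ∈ A.F n p := by
  subst h
  simpa using hxy

/-- The shifted cone of the identity of `B`, with filtration
`F_p M^n = F_p B^n ⊕ F_{p+r} B^{n-1}`. -/
def pathCone (r : ℕ) (B : FilteredComplex R) : FilteredComplex R where
  X n := B.X n × B.X (n - 1)
  d i j := (B.d i j ∘ₗ LinearMap.fst R _ _).prod
    (B.transport i (j - 1) ∘ₗ LinearMap.fst R _ _ -
      B.d (i - 1) (j - 1) ∘ₗ LinearMap.snd R _ _)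
  d_ne i j h := by
    rw [B.d_ne i j h, B.transport_of_ne (by omega), B.d_ne (i - 1) (j - 1) (by omega)]
    ext <;> simp
  d_sq i j k x := by
    ext <;> simp [B.d_sq, B.transport_d]
  F n p := (B.F n p).prod (B.F (n - 1) (p + r))
  F_mono n _ _ h := Submodule.prod_mono (B.F_mono n h) (B.F_mono (n - 1) (by omega))
  d_filt i j p x hx := ⟨B.d_filt i j p _ hx.1, sub_mem
    (B.transport_mem _ _ _ (B.F_mono _ (by omega) hx.1)) (B.d_filt _ _ _ _ hx.2)⟩

theorem pathCone_d_apply (r : ℕ) (B : FilteredComplex R) (i j : ℤ) (x : B.X i)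
    (y : B.X (i - 1)) :
    (pathCone r B).d i j (x, y) =
      (B.d i j x, B.transport i (j - 1) x - B.d (i - 1) (j - 1) y) :=
  rfl

theorem mk_zero_mem_Zc_pathCone (r : ℕ) (B : FilteredComplex R) {p n : ℤ} {b : B.X n}
    (hb : b ∈ Zc B r p n) :
    ((b, 0) : B.X n × B.X (n - 1)) ∈ Zc (pathCone r B) r p n := by
  rw [mem_Zc_iff _ _ _ rfl] at hb
  refine (mem_Zc_iff (pathCone r B) r p rfl _).2 ⟨⟨hb.1, zero_mem _⟩, hb.2, ?_⟩
  rw [pathCone_d_apply, map_zero, sub_zero, sub_add_cancel]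
  exact B.transport_mem _ _ _ hb.1

theorem Zc_pathCone_le_Bd (r : ℕ) (B : FilteredComplex R) (p n : ℤ) :
    Zc (pathCone r B) (r + 1) p n ≤ Bd (pathCone r B) (r + 1) p n := by
  rintro ⟨x, y⟩ h
  obtain ⟨⟨hx, hy⟩, hdx, hxy⟩ := (mem_Zc_iff (pathCone r B) _ _ rfl _).1 h
  rw [pathCone_d_apply] at hdx hxy
  dsimp only at hx hy hdx hxy
  have hdiff : x - B.d (n - 1) n y ∈ B.F n (p - 1) :=
    B.mem_of_transport_sub_mem (m := n + 1 - 1) (by omega) (B.F_mono _ (by omega) hxy)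
  have hdy : B.d (n - 1) n y ∈ B.F n p := by
    have := sub_mem hx (B.F_mono n (by omega) hdiff : x - B.d (n - 1) n y ∈ B.F n p)
    rwa [sub_sub_cancel] at this
  refine Submodule.mem_sup.2 ⟨_, mk_zero_mem_Zc_pathCone r B (b := x - B.d (n - 1) n y) ?_,
    _, Submodule.mem_map_of_mem (mk_zero_mem_Zc_pathCone r B (b := y) ?_), ?_⟩
  · refine (mem_Zc_iff B r (p - 1) rfl _).2 ⟨hdiff, ?_⟩
    rw [map_sub, B.d_sq, sub_zero]
    exact B.F_mono _ (by omega) hdx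
  · exact (mem_Zc_iff B r _ (by omega : n = n - 1 + 1) _).2
      ⟨B.F_mono _ (by omega) hy, B.F_mono _ (by omega) hdy⟩
  · rw [pathCone_d_apply, transport_self, map_zero, sub_zero]
    exact Prod.ext (sub_add_cancel _ _) (zero_add _)

end FilteredComplex

open FilteredComplex

/-- The map `A ⊕ M_r(B) → B` given by `f` and the first projection. -/
def FCHom.descPathCone {A B : FilteredComplex R} (f : FCHom A B) (r : ℕ) :
    FCHom (A.prod (pathCone r B)) B where
  f n := (f.f n).coprod (LinearMap.fst R (B.X n) (B.X (n - 1)))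
  comm i j x := by
    change f.f j (A.d i j x.1) + B.d i j x.2.1 = B.d i j (f.f i x.1 + x.2.1)
    rw [map_add, f.comm]
  filt n p x hx := add_mem (f.filt n p _ hx.1) hx.2.1

theorem FCHom.ZSurjF_descPathCone {A B : FilteredComplex R} (f : FCHom A B) (r : ℕ) :
    ZSurjF (f.descPathCone r) r := by
  intro p n b hb
  have h := (mem_Zc_iff (pathCone r B) r p rfl _).1 (mk_zero_mem_Zc_pathCone r B hb)
  refine ⟨(0, b, 0), (mem_Zc_iff (A.prod (pathCone r B)) r p rfl _).2
    ⟨⟨zero_mem _, h.1⟩, ?_, h.2⟩, ?_⟩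
  · change A.d n (n + 1) 0 ∈ _
    rw [map_zero]
    exact zero_mem _
  · change f.f n 0 + b = b
    rw [map_zero, zero_add]

/-- The inclusion of the first summand. -/
def FCHom.inl (A B : FilteredComplex R) : FCHom A (A.prod B) where
  f n := LinearMap.inl R (A.X n) (B.X n)
  comm i j _ := Prod.ext rfl (map_zero (B.d i j)).symm
  filt _ _ _ hx := ⟨hx, zero_mem _⟩

/-- The projection to the first summand. -/
def FCHom.fst (A B : FilteredComplex R) : FCHom (A.prod B) A where
  f n := LinearMap.fst R (A.X n) (B.X n)
  comm _ _ _ := rfl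
  filt _ _ _ hx := hx.1

/-- The projection to the second summand. -/
def FCHom.snd (A B : FilteredComplex R) : FCHom (A.prod B) B where
  f n := LinearMap.snd R (A.X n) (B.X n)
  comm _ _ _ := rfl
  filt _ _ _ hx := hx.2

/-- The first projection `M_r(B) → B`. -/
def FCHom.pathConeFst (r : ℕ) (B : FilteredComplex R) : FCHom (pathCone r B) B where
  f n := LinearMap.fst R (B.X n) (B.X (n - 1))
  comm _ _ _ := rfl
  filt _ _ _ hx := hx.1

/-- If `f : A → B` has the left lifting property with respect to every morphism `g`
of filtered complexes such that `Z_r(g)` is bidegree-wise surjective, then `f` is an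
`E_r`-quasi-isomorphism. -/
theorem stmt19 {R : Type} [CommRing R] {A B : FilteredComplex R} (f : FCHom A B) (r : ℕ)
    (hllp : ∀ (C D : FilteredComplex R) (g : FCHom C D), ZSurjF g r →
      ∀ (α : FCHom A C) (β : FCHom B D), FCHom.comp g α = FCHom.comp β f →
        ∃ γ : FCHom B C, FCHom.comp γ f = α ∧ FCHom.comp g γ = β) :
    IsErQisF f r := by
  obtain ⟨γ, hγf, hγ⟩ := hllp _ _ (f.descPathCone r) (f.ZSurjF_descPathCone r)
    (FCHom.inl A (pathCone r B)) (FCHom.id' B) (by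
      simp only [FCHom.comp, FCHom.mk.injEq]
      funext n
      ext a
      change f.f n a + 0 = f.f n a
      rw [add_zero])
  have hretract (n : ℤ) (a : A.X n) : (γ.f n (f.f n a)).1 = a :=
    congrArg Prod.fst (congrArg (fun φ : FCHom A (A.prod (pathCone r B)) => φ.f n a) hγf)
  have hsection (n : ℤ) (b : B.X n) : f.f n (γ.f n b).1 + (γ.f n b).2.1 = b :=
    congrArg (fun φ : FCHom B B => φ.f n b) hγ
  let s := (FCHom.fst A (pathCone r B)).comp γ
  let t := (FCHom.snd A (pathCone r B)).comp γ
  refine ⟨fun p n b hb => ⟨s.f n b, s.map_mem_Zc hb, ?_⟩, fun p n a _ ha => ?_⟩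
  · have ht := (FCHom.pathConeFst r B).map_mem_Bd (Zc_pathCone_le_Bd r B p n (t.map_mem_Zc hb))
    have heq : f.f n (s.f n b) - b = -(FCHom.pathConeFst r B).f n (t.f n b) :=
      sub_eq_iff_eq_add.2 (eq_neg_add_of_add_eq ((add_comm _ _).trans (hsection n b)))
    rw [heq]
    exact neg_mem ht
  · have := s.map_mem_Bd ha
    rwa [show s.f n (f.f n a) = a from hretract n a] at this
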